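/- For every real number p > 1 there exists a set A ⊆ ℝ² which has Lebesgue measure zero and is power-p-porous, and such that the set of curves γ ∈ Γ₁(ℝ²) on which A has Lebesgue measure zero (i.e. {γ ∈ Γ₁(ℝ²) : |{t ∈ [0,1] : γ(t) ∈ A}| = 0}) is not residual in Γ₁(ℝ²). Indeed there exist a nonempty open set U ⊆ Γ₁(ℝ²) and a residual set R ⊆ Γ₁(ℝ²) such that {t ∈ [0,1] : γ(t) ∈ A} has positive Lebesgue measure for every γ ∈ U ∩ R. -/

import Mathlib

open Set MeasureTheory Metric Topology
open scoped ENNReal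

noncomputable section

/-- The space `Γ₁(H)` of `C¹` curves `[0,1] → H`, encoded as pairs
`(γ, γ')` of continuous maps such that `γ'` is the (one-sided at the endpoints)
derivative of `γ` on `[0,1]`. -/
def Gamma1 (H : Type*) [NormedAddCommGroup H] [NormedSpace ℝ H] : Type _ :=
  {p : C(Icc (0:ℝ) 1, H) × C(Icc (0:ℝ) 1, H) //
    ∀ t ∈ Icc (0:ℝ) 1,
      HasDerivWithinAt (IccExtend zero_le_one ⇑p.1) (IccExtend zero_le_one ⇑p.2 t) (Icc 0 1) t}

/-- The metric on `Γ₁(H)` induced by the norm `‖γ‖_∞ + ‖γ'‖_∞`. -/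
noncomputable instance Gamma1.metricSpace (H : Type*) [NormedAddCommGroup H]
    [NormedSpace ℝ H] : MetricSpace (Gamma1 H) where
  dist f g := ‖f.1.1 - g.1.1‖ + ‖f.1.2 - g.1.2‖
  dist_self f := by simp
  dist_comm f g := by
    simp only [norm_sub_rev f.1.1 g.1.1, norm_sub_rev f.1.2 g.1.2]
  dist_triangle f g h := by
    change ‖f.1.1 - h.1.1‖ + ‖f.1.2 - h.1.2‖ ≤
      (‖f.1.1 - g.1.1‖ + ‖f.1.2 - g.1.2‖) + (‖g.1.1 - h.1.1‖ + ‖g.1.2 - h.1.2‖)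
    have h1 := dist_triangle f.1.1 g.1.1 h.1.1
    have h2 := dist_triangle f.1.2 g.1.2 h.1.2
    simp only [dist_eq_norm] at h1 h2
    linarith
  eq_of_dist_eq_zero := by
    intro f g hfg
    change ‖f.1.1 - g.1.1‖ + ‖f.1.2 - g.1.2‖ = 0 at hfg
    have n1 := norm_nonneg (f.1.1 - g.1.1)
    have n2 := norm_nonneg (f.1.2 - g.1.2)
    have e1 : ‖f.1.1 - g.1.1‖ = 0 := by linarith
    have e2 : ‖f.1.2 - g.1.2‖ = 0 := by linarith
    have q1 : f.1.1 = g.1.1 := sub_eq_zero.mp (norm_eq_zero.mp e1)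
    have q2 : f.1.2 = g.1.2 := sub_eq_zero.mp (norm_eq_zero.mp e2)
    exact Subtype.ext (Prod.ext q1 q2)

/-- The outer Lebesgue measure of the set of times `t ∈ [0,1]` at which a curve
`γ ∈ Γ₁(H)` lies in the set `E`. -/
def Gamma1.measOn {H : Type*} [NormedAddCommGroup H] [NormedSpace ℝ H]
    (γ : Gamma1 H) (E : Set H) : ℝ≥0∞ :=
  volume (Subtype.val '' (⇑γ.1.1 ⁻¹' E))


/-- `P` is power-`p`-porous: at every `x ∈ P` and every scale `ε > 0` there is a hole
`B(h,r)` of `P` with `d(h,x) < ε` and `r > d(h,x)^p`. -/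
def IsPowerPorous {M : Type*} [MetricSpace M] (p : ℝ) (P : Set M) : Prop :=
  ∀ x ∈ P, ∀ ε > 0, ∃ h : M, ∃ r > 0,
    dist h x < ε ∧ Metric.ball h r ∩ P = ∅ ∧ r > dist h x ^ p

namespace Gamma1

variable {H : Type*} [NormedAddCommGroup H] [NormedSpace ℝ H]

theorem dist_def (f g : Gamma1 H) : dist f g = ‖f.1.1 - g.1.1‖ + ‖f.1.2 - g.1.2‖ := rfl

theorem lipschitzWith_val : LipschitzWith 1 (fun γ : Gamma1 H ↦ γ.1) := by
  refine LipschitzWith.of_dist_le_mul fun f g ↦ ?_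
  rw [dist_def, Prod.dist_eq, dist_eq_norm, dist_eq_norm, NNReal.coe_one, one_mul]
  exact max_le (le_add_of_nonneg_right (norm_nonneg _)) (le_add_of_nonneg_left (norm_nonneg _))

theorem antilipschitzWith_val : AntilipschitzWith 2 (fun γ : Gamma1 H ↦ γ.1) := by
  refine AntilipschitzWith.of_le_mul_dist fun f g ↦ ?_
  rw [dist_def, Prod.dist_eq, dist_eq_norm, dist_eq_norm, NNReal.coe_ofNat, two_mul]
  exact add_le_add (le_max_left _ _) (le_max_right _ _)

theorem isUniformEmbedding_val : IsUniformEmbedding (fun γ : Gamma1 H ↦ γ.1) :=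
  antilipschitzWith_val.isUniformEmbedding lipschitzWith_val.uniformContinuous

instance [SecondCountableTopology H] : SecondCountableTopology (Gamma1 H) :=
  isUniformEmbedding_val.isEmbedding.secondCountableTopology

/-- Being the derivative of a curve on `[0,1]` is equivalent to the integral identity of the
fundamental theorem of calculus. -/
theorem hasDerivWithinAt_iff_eq_integral [CompleteSpace H]
    (q : C(Icc (0:ℝ) 1, H) × C(Icc (0:ℝ) 1, H)) :
    (∀ t ∈ Icc (0:ℝ) 1,
      HasDerivWithinAt (IccExtend zero_le_one ⇑q.1) (IccExtend zero_le_one ⇑q.2 t) (Icc 0 1) t) ↔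
    ∀ t ∈ Icc (0:ℝ) 1, IccExtend zero_le_one ⇑q.1 t =
      IccExtend zero_le_one ⇑q.1 0 + ∫ s in (0:ℝ)..t, IccExtend zero_le_one ⇑q.2 s := by
  have hc : Continuous (IccExtend zero_le_one ⇑q.2) := q.2.continuous.Icc_extend'
  constructor
  · intro h t ht
    have := intervalIntegral.integral_eq_sub_of_hasDerivAt_of_le ht.1
      (q.1.continuous.Icc_extend' (h := zero_le_one)).continuousOn
      (fun x hx ↦ (h x ⟨hx.1.le, hx.2.le.trans ht.2⟩).hasDerivAt
        (Icc_mem_nhds hx.1 (hx.2.trans_le ht.2)))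
      (hc.intervalIntegrable 0 t)
    rw [this, add_sub_cancel]
  · intro h t ht
    have hd : HasDerivAt (fun t : ℝ ↦ IccExtend zero_le_one ⇑q.1 0 +
        ∫ s in (0:ℝ)..t, IccExtend zero_le_one ⇑q.2 s) (IccExtend zero_le_one ⇑q.2 t) t :=
      (hc.integral_hasStrictDerivAt 0 t).hasDerivAt.const_add _
    exact hd.hasDerivWithinAt.congr (fun s hs ↦ h s hs) (h t ht)

instance [CompleteSpace H] : CompleteSpace (Gamma1 H) := by
  rw [completeSpace_iff_isComplete_range isUniformEmbedding_val.isUniformInducing]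
  refine IsClosed.isComplete ?_
  have hr : range (fun γ : Gamma1 H ↦ γ.1) =
      {q : C(Icc (0:ℝ) 1, H) × C(Icc (0:ℝ) 1, H) | ∀ t ∈ Icc (0:ℝ) 1, IccExtend zero_le_one ⇑q.1 t =
        IccExtend zero_le_one ⇑q.1 0 + ∫ s in (0:ℝ)..t, IccExtend zero_le_one ⇑q.2 s} := by
    ext q
    rw [mem_ofPred_eq, ← hasDerivWithinAt_iff_eq_integral]
    exact ⟨fun ⟨γ, hγ⟩ ↦ hγ ▸ γ.2, fun hq ↦ ⟨⟨q, hq⟩, rfl⟩⟩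
  rw [hr]
  simp only [ofPred_forall]
  refine isClosed_iInter fun t ↦ isClosed_iInter fun _ ↦ isClosed_eq ?_ ?_
  · simp only [IccExtend, Function.comp_apply]
    fun_prop
  · refine Continuous.add ?_ (intervalIntegral.continuous_parametric_intervalIntegral_of_continuous'
      ?_ _ _)
    · simp only [IccExtend, Function.comp_apply]
      fun_prop
    · have : Continuous (projIcc (0:ℝ) 1 zero_le_one) := continuous_projIcc
      simp only [IccExtend, Function.comp_def, Function.uncurry_def]
      fun_prop

/-- The image of a `C¹` curve in the plane is null. -/
theorem volume_range_eq_zero (γ : Gamma1 (EuclideanSpace ℝ (Fin 2))) :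
    volume (range γ.1.1) = 0 := by
  obtain ⟨C, hC⟩ := (isCompact_range γ.1.2.continuous).isBounded.exists_norm_le
  have hLip : LipschitzOnWith C.toNNReal (IccExtend zero_le_one ⇑γ.1.1) (Icc 0 1) :=
    (convex_Icc (0:ℝ) 1).lipschitzOnWith_of_nnnorm_hasDerivWithin_le γ.2 fun t _ ↦
      NNReal.le_toNNReal_of_coe_le (hC _ ⟨_, rfl⟩)
  have himage : range γ.1.1 ⊆ IccExtend zero_le_one ⇑γ.1.1 '' Icc (0:ℝ) 1 := by
    rintro _ ⟨t, rfl⟩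
    exact ⟨t, t.2, IccExtend_val _ _ t⟩
  have hdim : dimH (range γ.1.1) < ((2 : NNReal) : ℝ≥0∞) := by
    calc _ ≤ dimH (Icc (0:ℝ) 1) := (dimH_mono himage).trans hLip.dimH_image_le
      _ ≤ dimH (univ : Set ℝ) := dimH_mono (subset_univ _)
      _ = 1 := Real.dimH_univ
      _ < _ := by norm_num
  have h0 := hausdorffMeasure_of_dimH_lt hdim
  rw [NNReal.coe_ofNat] at h0
  have hfin : Module.finrank ℝ (EuclideanSpace ℝ (Fin 2)) = 2 := by simp
  have : (Measure.hausdorffMeasure (2:ℝ) :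
      Measure (EuclideanSpace ℝ (Fin 2))).IsAddHaarMeasure := by
    have := isAddHaarMeasure_hausdorffMeasure (E := EuclideanSpace ℝ (Fin 2))
    rwa [hfin, Nat.cast_ofNat] at this
  exact Measure.absolutelyContinuous_isAddHaarMeasure _ _ h0

theorem continuous_curve : Continuous (fun γ : Gamma1 H ↦ γ.1.1) :=
  continuous_fst.comp isUniformEmbedding_val.uniformContinuous.continuous

/-- Some null set contains the image of a typical `C¹` curve in the plane. -/
theorem exists_null_eventually_range_subset :
    ∃ N : Set (EuclideanSpace ℝ (Fin 2)), volume N = 0 ∧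
      {γ : Gamma1 (EuclideanSpace ℝ (Fin 2)) | range γ.1.1 ⊆ N} ∈
        residual (Gamma1 (EuclideanSpace ℝ (Fin 2))) := by
  have key : ∀ n : ℕ, ∃ G : Set (EuclideanSpace ℝ (Fin 2)), IsOpen G ∧
      volume G ≤ ((n : ℝ≥0∞) + 1)⁻¹ ∧
      Dense {γ : Gamma1 (EuclideanSpace ℝ (Fin 2)) | range γ.1.1 ⊆ G} := by
    intro n
    obtain ⟨S, hSc, hSd⟩ := TopologicalSpace.exists_countable_dense
      (Gamma1 (EuclideanSpace ℝ (Fin 2)))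
    have : Countable S := hSc.to_subtype
    obtain ⟨δ, hδ, hδsum⟩ := ENNReal.exists_pos_sum_of_countable'
      (ε := ((n : ℝ≥0∞) + 1)⁻¹) (by simp) S
    choose V hVsub hVo hV using fun γ : S ↦ Set.exists_isOpen_lt_of_lt (μ := volume)
      (range γ.1.1.1) (δ γ) (by rw [volume_range_eq_zero]; exact hδ γ)
    refine ⟨⋃ γ, V γ, isOpen_iUnion hVo, ?_, hSd.mono fun γ hγ ↦ ?_⟩
    · exact (measure_iUnion_le _).trans ((ENNReal.tsum_le_tsum fun γ ↦ (hV γ).le).trans hδsum.le)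
    · exact (hVsub ⟨γ, hγ⟩).trans (subset_iUnion V _)
  choose G hGo hG hGd using key
  refine ⟨⋂ n, G n, ?_, ?_⟩
  · refine le_antisymm (ge_of_tendsto' (f := fun n : ℕ ↦ ((n : ℝ≥0∞) + 1)⁻¹) (x := Filter.atTop)
      ?_ fun n ↦ (measure_mono (iInter_subset G n)).trans (hG n)) zero_le
    have := (Filter.tendsto_add_atTop_iff_nat 1).2 ENNReal.tendsto_inv_nat_nhds_zero
    simpa using this
  · simp only [subset_iInter_iff, ofPred_forall]
    refine countable_iInter_mem.2 fun n ↦ residual_of_dense_open ?_ (hGd n)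
    have := (ContinuousMap.isOpen_setOfPred_mapsTo (X := Icc (0:ℝ) 1)
      isCompact_univ (hGo n)).preimage (continuous_curve (H := EuclideanSpace ℝ (Fin 2)))
    simpa [mapsTo_univ_iff, range_subset_iff, preimage] using this

end Gamma1

/-- The union of the intervals of radius `N ^ (-p)` about the multiples of `1 / N`. -/
def latticeGaps (p : ℝ) (N : ℕ) : Set ℝ := ⋃ m : ℤ, ball ((m : ℝ) / N) ((N : ℝ) ^ (-p))

theorem volume_Icc_inter_latticeGaps_le {p : ℝ} (hp : 0 ≤ p) {N : ℕ} (hN : 0 < N) :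
    volume (Icc (0:ℝ) 1 ∩ latticeGaps p N) ≤ ENNReal.ofReal (8 * (N : ℝ) ^ (1 - p)) := by
  have hN' : (1:ℝ) ≤ N := by exact_mod_cast hN
  have hN0 : (0:ℝ) < N := by linarith
  have hr : (N : ℝ) ^ (-p) ≤ 1 := Real.rpow_le_one_of_one_le_of_nonpos hN' (by linarith)
  have hsub : Icc (0:ℝ) 1 ∩ latticeGaps p N ⊆
      ⋃ m ∈ Finset.Icc (-(N:ℤ)) (2 * N), ball ((m : ℝ) / N) ((N : ℝ) ^ (-p)) := by
    rintro x ⟨hx, hxm⟩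
    obtain ⟨m, hm⟩ := mem_iUnion.1 hxm
    have h := abs_lt.1 (Real.dist_eq _ _ ▸ mem_ball.1 hm)
    refine mem_biUnion (Finset.mem_coe.2 (Finset.mem_Icc.2 ⟨?_, ?_⟩)) hm
    · have : (-1:ℝ) ≤ m / N := by linarith [hx.1, h.2]
      rw [le_div_iff₀ hN0] at this
      have : ((-N : ℤ) : ℝ) ≤ m := by push_cast; linarith
      exact_mod_cast this
    · have : (m / N : ℝ) ≤ 2 := by linarith [hx.2, h.1]
      rw [div_le_iff₀ hN0] at this
      exact_mod_cast this
  calc _ ≤ _ := measure_mono hsub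
    _ ≤ ∑ m ∈ Finset.Icc (-(N:ℤ)) (2 * N), volume (ball ((m : ℝ) / N) ((N : ℝ) ^ (-p))) :=
      measure_biUnion_finset_le _ _
    _ = ENNReal.ofReal ((3 * N + 1) * (2 * (N : ℝ) ^ (-p))) := by
      have hcard : (2 * (N:ℤ) + 1 - -N).toNat = 3 * N + 1 := by omega
      simp only [Real.volume_ball, Finset.sum_const, Int.card_Icc, hcard, nsmul_eq_mul]
      rw [ENNReal.ofReal_mul (p := 3 * (N : ℝ) + 1) (by positivity), ← ENNReal.ofReal_natCast]
      push_cast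
      rfl
    _ ≤ _ := by
      refine ENNReal.ofReal_le_ofReal ?_
      rw [sub_eq_add_neg, Real.rpow_add hN0, Real.rpow_one]
      have : 0 ≤ (N : ℝ) ^ (-p) := by positivity
      nlinarith

/-- Infinitely many families of lattice gaps can be removed from `[0,1]` while keeping positive
measure. -/
theorem exists_latticeGaps_sparse {p : ℝ} (hp : 1 < p) :
    ∃ N : ℕ → ℕ, (∀ k, k < N k) ∧ 0 < volume (Icc (0:ℝ) 1 \ ⋃ k, latticeGaps p (N k)) := by
  obtain ⟨δ, hδ, hδsum⟩ := ENNReal.exists_pos_sum_of_countable' (ε := 1) one_ne_zero ℕ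
  have hlim : Filter.Tendsto (fun N : ℕ ↦ ENNReal.ofReal (8 * (N : ℝ) ^ (1 - p)))
      Filter.atTop (𝓝 0) := by
    have h := ((tendsto_rpow_neg_atTop (y := p - 1) (by linarith)).comp
      tendsto_natCast_atTop_atTop).const_mul (8:ℝ)
    simpa [neg_sub] using ENNReal.tendsto_ofReal h
  choose N hN hNk using fun k ↦
    ((hlim.eventually_lt_const (hδ k)).and (Filter.eventually_gt_atTop k)).exists
  refine ⟨N, hNk, ?_⟩
  have hlt : volume (Icc (0:ℝ) 1 ∩ ⋃ k, latticeGaps p (N k)) < volume (Icc (0:ℝ) 1) := by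
    rw [inter_iUnion, Real.volume_Icc, sub_zero, ENNReal.ofReal_one]
    refine ((measure_iUnion_le _).trans (ENNReal.tsum_le_tsum fun k ↦ ?_)).trans_lt hδsum
    exact (volume_Icc_inter_latticeGaps_le (by linarith) (by have := hNk k; omega)).trans (hN k).le
  rw [← sdiff_inter_self_eq_sdiff, inter_comm]
  exact (tsub_pos_of_lt hlt).trans_le le_measure_sdiff

/-- Removing the lattice gaps of unboundedly fine lattices leaves a power-porous set. -/
theorem isPowerPorous_compl_latticeGaps {p : ℝ} (hp : 0 < p) {N : ℕ → ℕ} (hN : ∀ k, k < N k) :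
    IsPowerPorous p {x : EuclideanSpace ℝ (Fin 2) | x 0 ∉ ⋃ k, latticeGaps p (N k)} := by
  intro x _ ε hε
  obtain ⟨k, hk⟩ := exists_nat_one_div_lt hε
  have hN0 : (0:ℝ) < N k := by exact_mod_cast (Nat.zero_le k).trans_lt (hN k)
  set a : ℝ := round (x 0 * N k) / N k with ha
  have hdist : dist (!₂[a, x 1]) x = |a - x 0| := by
    simp [EuclideanSpace.dist_eq, Fin.sum_univ_two, Real.dist_eq, Real.sqrt_sq_eq_abs]
  have hle : |a - x 0| ≤ (1 / 2) / N k := by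
    have h := abs_sub_round (x 0 * N k)
    rw [abs_sub_comm, le_div_iff₀ hN0]
    calc |x 0 - a| * N k = |x 0 * N k - round (x 0 * N k)| := by
          rw [← abs_of_pos hN0, ← abs_mul, abs_of_pos hN0, sub_mul, ha, div_mul_cancel₀ _ hN0.ne']
      _ ≤ _ := h
  have hlt : |a - x 0| < (N k : ℝ)⁻¹ := by
    refine hle.trans_lt ?_
    rw [div_eq_mul_inv]
    have := inv_pos.2 hN0
    linarith
  refine ⟨!₂[a, x 1], (N k : ℝ) ^ (-p), by positivity, ?_, ?_, ?_⟩
  · rw [hdist]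
    refine hlt.trans (lt_of_le_of_lt ?_ hk)
    rw [one_div]
    refine inv_anti₀ (by positivity) ?_
    exact_mod_cast hN k
  · rw [← disjoint_iff_inter_eq_empty, Set.disjoint_left]
    intro y hy hyC
    refine hyC (mem_iUnion.2 ⟨k, mem_iUnion.2 ⟨round (x 0 * N k), ?_⟩⟩)
    refine mem_ball.2 (lt_of_le_of_lt ?_ (mem_ball.1 hy))
    have := PiLp.norm_apply_le (y - !₂[a, x 1]) 0
    simpa [Real.dist_eq, dist_eq_norm, ha] using this
  · rw [hdist, gt_iff_lt, Real.rpow_neg hN0.le, ← Real.inv_rpow hN0.le]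
    exact Real.rpow_lt_rpow (abs_nonneg _) hlt hp

theorem IsPowerPorous.mono {M : Type*} [MetricSpace M] {p : ℝ} {P Q : Set M}
    (hQ : IsPowerPorous p Q) (h : P ⊆ Q) : IsPowerPorous p P := by
  intro x hx ε hε
  obtain ⟨z, r, hr, hz, hball, hlt⟩ := hQ x (h hx) ε hε
  exact ⟨z, r, hr, hz, subset_eq_empty (inter_subset_inter_right _ h) hball, hlt⟩

/-- A `C¹` curve whose first coordinate traverses `[0,1]` spends positive time over every subset
of `[0,1]` of positive measure. -/
theorem Gamma1.measOn_pos_of_crossing (γ : Gamma1 (EuclideanSpace ℝ (Fin 2)))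
    (h0 : γ.1.1 0 0 < 0) (h1 : 1 < γ.1.1 1 0) {K : Set ℝ} (hK : 0 < volume (Icc (0:ℝ) 1 ∩ K)) :
    0 < Gamma1.measOn γ {x | x 0 ∈ K} := by
  rw [pos_iff_ne_zero]
  intro hzero
  set f : ℝ → ℝ := fun t ↦ IccExtend zero_le_one ⇑γ.1.1 t 0 with hf
  have hdiff : DifferentiableOn ℝ f (Icc 0 1) := fun t ht ↦
    ((EuclideanSpace.proj (𝕜 := ℝ) (0 : Fin 2)).differentiableAt.comp_differentiableWithinAt t
      (γ.2 t ht).differentiableWithinAt)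
  have hf0 : f 0 < 0 := by
    rw [hf]; simpa [IccExtend_left] using h0
  have hf1 : 1 < f 1 := by
    rw [hf]; simpa [IccExtend_right] using h1
  have hnull := addHaar_image_eq_zero_of_differentiableOn_of_addHaar_eq_zero volume
    (hdiff.mono (Subtype.coe_image_subset _ (γ.1.1 ⁻¹' {x | x 0 ∈ K}))) hzero
  refine hK.ne' (measure_mono_null ?_ hnull)
  rintro y ⟨hy, hyK⟩
  obtain ⟨t, ht, rfl⟩ := intermediate_value_Icc zero_le_one hdiff.continuousOn
    ⟨hf0.le.trans hy.1, hy.2.trans hf1.le⟩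
  refine ⟨t, ⟨⟨t, ht⟩, ?_, rfl⟩, rfl⟩
  simpa [hf, IccExtend_of_mem _ _ ht] using hyK

/-- The affine curve `t ↦ (3 * t - 1, 0)`. -/
def crossingCurve : Gamma1 (EuclideanSpace ℝ (Fin 2)) :=
  ⟨(⟨fun t ↦ (3 * (t : ℝ) - 1) • EuclideanSpace.single 0 1, by fun_prop⟩,
    ContinuousMap.const _ ((3:ℝ) • EuclideanSpace.single 0 1)), by
    intro t ht
    have hd : HasDerivAt (fun t : ℝ ↦ (3 * t - 1) • EuclideanSpace.single (0 : Fin 2) (1:ℝ))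
        ((3:ℝ) • EuclideanSpace.single (0 : Fin 2) (1:ℝ)) t := by
      have := (((hasDerivAt_id t).const_mul (3:ℝ)).sub_const 1).smul_const
        (EuclideanSpace.single (0 : Fin 2) (1:ℝ))
      simpa using this
    refine hd.hasDerivWithinAt.congr (fun s hs ↦ ?_) ?_
    · rw [IccExtend_of_mem _ _ hs]; rfl
    · rw [IccExtend_of_mem _ _ ht]; rfl⟩

/-- For every `p > 1` there is a Lebesgue-null, power-`p`-porous set
`A ⊆ ℝ²` such that `{γ ∈ Γ₁(ℝ²) : |γ⁻¹(A)| = 0}` is not residual in `Γ₁(ℝ²)`; indeed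
there are a nonempty open `U` and a residual `R` in `Γ₁(ℝ²)` such that `γ⁻¹(A)` has
positive Lebesgue measure for every `γ ∈ U ∩ R`. -/
theorem exists_powerPorous_null_not_gammaOneNull {p : ℝ} (hp : 1 < p) :
    ∃ A : Set (EuclideanSpace ℝ (Fin 2)), volume A = 0 ∧ IsPowerPorous p A ∧
      {γ : Gamma1 (EuclideanSpace ℝ (Fin 2)) | Gamma1.measOn γ A = 0} ∉
        residual (Gamma1 (EuclideanSpace ℝ (Fin 2))) ∧
      ∃ U R : Set (Gamma1 (EuclideanSpace ℝ (Fin 2))),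
        IsOpen U ∧ U.Nonempty ∧ R ∈ residual (Gamma1 (EuclideanSpace ℝ (Fin 2))) ∧
        ∀ γ ∈ U ∩ R, 0 < Gamma1.measOn γ A := by
  obtain ⟨N, hN, hpos⟩ := exists_latticeGaps_sparse hp
  obtain ⟨Z, hZ, hres⟩ := Gamma1.exists_null_eventually_range_subset
  set C : Set (EuclideanSpace ℝ (Fin 2)) := {x | x 0 ∉ ⋃ k, latticeGaps p (N k)}
  set U : Set (Gamma1 (EuclideanSpace ℝ (Fin 2))) := {γ | γ.1.1 0 0 < 0 ∧ 1 < γ.1.1 1 0}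
  have heval : ∀ t, Continuous fun γ : Gamma1 (EuclideanSpace ℝ (Fin 2)) ↦ γ.1.1 t 0 := fun t ↦ by
    have := Gamma1.continuous_curve (H := EuclideanSpace ℝ (Fin 2))
    fun_prop
  have hUo : IsOpen U :=
    (isOpen_lt (heval 0) continuous_const).inter (isOpen_lt continuous_const (heval 1))
  have hUne : U.Nonempty := ⟨crossingCurve, by
    constructor <;> simp [crossingCurve]
    norm_num⟩
  have hmeas : ∀ γ ∈ U ∩ {γ | range γ.1.1 ⊆ Z}, 0 < Gamma1.measOn γ (C ∩ Z) := by
    rintro γ ⟨hγU, hγZ⟩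
    have := γ.measOn_pos_of_crossing hγU.1 hγU.2 hpos
    rwa [Gamma1.measOn, preimage_inter, preimage_eq_univ_iff.2 hγZ, inter_univ]
  refine ⟨C ∩ Z, measure_mono_null inter_subset_right hZ,
    (isPowerPorous_compl_latticeGaps (by linarith) hN).mono inter_subset_left, fun h ↦ ?_,
    U, _, hUo, hUne, hres, hmeas⟩
  obtain ⟨γ, hγU, hγ0, hγZ⟩ :=
    (dense_of_mem_residual (Filter.inter_mem h hres)).inter_open_nonempty U hUo hUne
  exact (hmeas γ ⟨hγU, hγZ⟩).ne' hγ0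

end
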